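/- arXiv:2101.03593 — 4 statements merged into one kernel-verified Lean document; each statement's English description precedes it below -/
import Mathlib

section
/- (Weak Deduction Theorem) For all formulas A and B: A ⊨ B if and only if ⊨ A → B. -/
inductive Formula (α : Type) : Type
  | atom : α → Formula α
  | neg : Formula α → Formula α
  | conj : Formula α → Formula α → Formula α
  | disj : Formula α → Formula α → Formula α
  | imp : Formula α → Formula α → Formula α

structure Frame (S : Type) : Type where
  S_nonempty : Nonempty S
  L : S → Prop
  L_nonempty : ∃ u, L u
  R1 : S → S → S → Prop
  R2 : S → S → S → Prop
  le_refl : ∀ x, ∃ u, L u ∧ R1 u x x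
  le_trans : ∀ x y z, (∃ u, L u ∧ R1 u x y) → (∃ u, L u ∧ R1 u y z) →
      (∃ u, L u ∧ R1 u x z)
  L_up : ∀ x y, L x → (∃ u, L u ∧ R1 u x y) → L y
  R1_down : ∀ w x y z, (∃ u, L u ∧ R1 u w x) → R1 x y z → R1 w y z
  R2_up : ∀ x w y z, (∃ u, L u ∧ R1 u x w) → R2 x y z → R2 w y z

def Frame.le {S : Type} (F : Frame S) (x y : S) : Prop := ∃ u, F.L u ∧ F.R1 u x y

structure Model (S α : Type) : Type where
  F : Frame S
  vT : S → α → Prop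
  vF : S → α → Prop
  persT : ∀ x y p, F.le x y → vT x p → vT y p
  persF : ∀ x y p, F.le x y → vF x p → vF y p

def Model.sat {S α : Type} (M : Model S α) : Formula α → S → Prop × Prop
  | .atom p, x => (M.vT x p, M.vF x p)
  | .neg A, x => ((M.sat A x).2, (M.sat A x).1)
  | .conj A B, x => ((M.sat A x).1 ∧ (M.sat B x).1, (M.sat A x).2 ∨ (M.sat B x).2)
  | .disj A B, x => ((M.sat A x).1 ∨ (M.sat B x).1, (M.sat A x).2 ∧ (M.sat B x).2)
  | .imp A B, x =>
      ((∀ y z, M.F.R1 x y z → (M.sat A y).1 → (M.sat B z).1),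
       (∃ y z, M.F.R2 x y z ∧ (M.sat A y).1 ∧ (M.sat B z).2))

def Model.satT {S α : Type} (M : Model S α) (x : S) (A : Formula α) : Prop := (M.sat A x).1

def Model.satF {S α : Type} (M : Model S α) (x : S) (A : Formula α) : Prop := (M.sat A x).2

def Entails (α : Type) (A B : Formula α) : Prop :=
  ∀ (S : Type) (M : Model S α) (x : S), M.satT x A → M.satT x B

def Valid (α : Type) (A : Formula α) : Prop :=
  ∀ (S : Type) (M : Model S α) (x : S), M.F.L x → M.satT x A

/-- Truth and falsity of formulas are hereditary along `≤`. -/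
theorem Model.sat_mono {S α : Type} (M : Model S α) (A : Formula α) {x y : S}
    (h : M.F.le x y) :
    ((M.sat A x).1 → (M.sat A y).1) ∧ ((M.sat A x).2 → (M.sat A y).2) := by
  induction A with
  | atom p => exact ⟨M.persT x y p h, M.persF x y p h⟩
  | neg A ih => exact ⟨ih.2, ih.1⟩
  | conj A B ihA ihB => exact ⟨And.imp ihA.1 ihB.1, Or.imp ihA.2 ihB.2⟩
  | disj A B ihA ihB => exact ⟨Or.imp ihA.1 ihB.1, And.imp ihA.2 ihB.2⟩
  | imp A B =>
    exact ⟨fun hx a b hR => hx a b (M.F.R1_down x y a b h hR),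
      fun ⟨a, b, hR, hA, hB⟩ => ⟨a, b, M.F.R2_up x y a b h hR, hA, hB⟩⟩

theorem weak_deduction_theorem {α : Type} (A B : Formula α) :
    Entails α A B ↔ Valid α (Formula.imp A B) := by
  constructor
  · intro h S M u hu y z hR hA
    exact (M.sat_mono B ⟨u, hu, hR⟩).1 (h S M y hA)
  · intro h S M x hA
    obtain ⟨u, hu, hR⟩ := M.F.le_refl x
    exact h S M u hu x x hR hA
end

section
/- (Soundness of A10) For all formulas A, B, C: ⊨ ¬((A ∨ B) → C) → (¬(A → C) ∨ ¬(B → C)). -/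
theorem soundness_A10 {α : Type} (A B C : Formula α) :
    Valid α (Formula.imp (Formula.neg (Formula.imp (Formula.disj A B) C))
      (Formula.disj (Formula.neg (Formula.imp A C)) (Formula.neg (Formula.imp B C)))) := by
  intro S M x hx y z hyz hy
  obtain ⟨u, v, huv, hA | hB, hC⟩ := (M.sat_mono _ ⟨x, hx, hyz⟩).1 hy
  · exact Or.inl ⟨u, v, huv, hA, hC⟩
  · exact Or.inr ⟨u, v, huv, hB, hC⟩
end

section
/- If ⊢ A → (B ∨ C) and ⊢ (D ∧ C) → E, then ⊢ (A ∧ D) → (B ∨ E). -/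
inductive Prov {α : Type} : Formula α → Prop
  | a1 (A : Formula α) : Prov (A.imp A)
  | a2l (A B : Formula α) : Prov (A.imp (A.disj B))
  | a2r (A B : Formula α) : Prov (B.imp (A.disj B))
  | a3l (A B : Formula α) : Prov ((A.conj B).imp A)
  | a3r (A B : Formula α) : Prov ((A.conj B).imp B)
  | a4 (A B C : Formula α) : Prov (((A.imp C).conj (B.imp C)).imp ((A.disj B).imp C))
  | a5 (A B C : Formula α) : Prov (((A.imp B).conj (A.imp C)).imp (A.imp (B.conj C)))
  | a6 (A B C : Formula α) : Prov ((A.conj (B.disj C)).imp ((A.conj B).disj C))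
  | a7l (A B : Formula α) : Prov ((A.disj B).neg.imp (A.neg.conj B.neg))
  | a7r (A B : Formula α) : Prov ((A.neg.conj B.neg).imp (A.disj B).neg)
  | a8l (A B : Formula α) : Prov ((A.conj B).neg.imp (A.neg.disj B.neg))
  | a8r (A B : Formula α) : Prov ((A.neg.disj B.neg).imp (A.conj B).neg)
  | a9l (A : Formula α) : Prov (A.imp A.neg.neg)
  | a9r (A : Formula α) : Prov (A.neg.neg.imp A)
  | a10 (A B C : Formula α) :
      Prov (((A.disj B).imp C).neg.imp ((A.imp C).neg.disj ((B.imp C).neg)))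
  | a11 (A B C : Formula α) :
      Prov ((A.imp (B.conj C)).neg.imp ((A.imp B).neg.disj ((A.imp C).neg)))
  | r1 {A B : Formula α} : Prov A → Prov (A.imp B) → Prov B
  | r2 {A B : Formula α} : Prov A → Prov B → Prov (A.conj B)
  | r3 {A B : Formula α} (C : Formula α) : Prov (A.imp B) → Prov ((C.imp A).imp (C.imp B))
  | r4 {A B : Formula α} (C : Formula α) : Prov (A.imp B) → Prov ((B.imp C).imp (A.imp C))
  | r5 {A B : Formula α} (C : Formula α) :
      Prov (A.imp B) → Prov ((A.imp C).neg.imp ((B.imp C).neg))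
  | r6 {A B : Formula α} (C : Formula α) :
      Prov (A.neg.imp B.neg) → Prov ((C.imp A).neg.imp ((C.imp B).neg))

def conjList {α : Type} : Formula α → List (Formula α) → Formula α
  | A, [] => A
  | A, B :: l => conjList (A.conj B) l

def disjList {α : Type} : Formula α → List (Formula α) → Formula α
  | A, [] => A
  | A, B :: l => disjList (A.disj B) l

/-- `X ⊢ B` : some finite nonempty conjunction of members of `X` provably implies `B`. -/
def SetProv {α : Type} (X : Set (Formula α)) (B : Formula α) : Prop :=
  ∃ (A : Formula α) (l : List (Formula α)),
    A ∈ X ∧ (∀ C ∈ l, C ∈ X) ∧ Prov ((conjList A l).imp B)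

/-- `X ⊢ Y` : `X` proves some finite nonempty disjunction of members of `Y`. -/
def SetProvSet {α : Type} (X Y : Set (Formula α)) : Prop :=
  ∃ (B : Formula α) (l : List (Formula α)),
    B ∈ Y ∧ (∀ C ∈ l, C ∈ Y) ∧ SetProv X (disjList B l)

def IsTheory {α : Type} (X : Set (Formula α)) : Prop :=
  X.Nonempty ∧ ∀ B, SetProv X B → B ∈ X

def IsPrime {α : Type} (X : Set (Formula α)) : Prop :=
  ∀ A B : Formula α, A.disj B ∈ X ↔ (A ∈ X ∨ B ∈ X)

namespace Prov

variable {α : Type} {A B C : Formula α}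

theorem imp_trans (h1 : Prov (A.imp B)) (h2 : Prov (B.imp C)) : Prov (A.imp C) :=
  r1 h1 (r3 A h2)

theorem imp_conj (h1 : Prov (A.imp B)) (h2 : Prov (A.imp C)) : Prov (A.imp (B.conj C)) :=
  r1 (r2 h1 h2) (a5 A B C)

theorem disj_imp (h1 : Prov (A.imp C)) (h2 : Prov (B.imp C)) : Prov ((A.disj B).imp C) :=
  r1 (r2 h1 h2) (a4 A B C)

end Prov

theorem cut_lemma {α : Type} (A B C D E : Formula α)
    (h1 : Prov (A.imp (B.disj C))) (h2 : Prov ((D.conj C).imp E)) :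
    Prov ((A.conj D).imp (B.disj E)) := by
  have hswap : Prov ((B.disj C).imp (C.disj B)) := Prov.disj_imp (.a2r C B) (.a2l C B)
  have hdist : Prov ((A.conj D).imp ((D.conj C).disj B)) :=
    ((Prov.a3r A D).imp_conj (((Prov.a3l A D).imp_trans h1).imp_trans hswap)).imp_trans
      (.a6 D C B)
  exact hdist.imp_trans (Prov.disj_imp (h2.imp_trans (.a2r B E)) (.a2l B E))
end

section
/- (Corollary to Lindenbaum's Lemma) Suppose the language is countable. Let X be a theory and Y a nonempty set of formulas disjoint from X and closed under disjunction (A∨B ∈ Y whenever A, B ∈ Y). Then there is a prime theory X′ with X ⊆ X′ and X′ disjoint from Y. -/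
namespace Prov

variable {α : Type} {A B C D : Formula α}

theorem trans (h₁ : Prov (A.imp B)) (h₂ : Prov (B.imp C)) : Prov (A.imp C) :=
  r1 h₁ (r3 A h₂)

theorem conj_intro (h₁ : Prov (A.imp B)) (h₂ : Prov (A.imp C)) : Prov (A.imp (B.conj C)) :=
  r1 (r2 h₁ h₂) (a5 A B C)

theorem disj_elim (h₁ : Prov (A.imp C)) (h₂ : Prov (B.imp C)) : Prov ((A.disj B).imp C) :=
  r1 (r2 h₁ h₂) (a4 A B C)

theorem conj_mono (h₁ : Prov (A.imp C)) (h₂ : Prov (B.imp D)) :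
    Prov ((A.conj B).imp (C.conj D)) :=
  conj_intro (trans (a3l A B) h₁) (trans (a3r A B) h₂)

theorem disj_mono (h₁ : Prov (A.imp C)) (h₂ : Prov (B.imp D)) :
    Prov ((A.disj B).imp (C.disj D)) :=
  disj_elim (trans h₁ (a2l C D)) (trans h₂ (a2r C D))

theorem disj_comm (A B : Formula α) : Prov ((A.disj B).imp (B.disj A)) :=
  disj_elim (a2r B A) (a2l B A)

theorem conj_disj_distrib (A B C : Formula α) :
    Prov ((A.conj (B.disj C)).imp ((A.conj B).disj (A.conj C))) :=
  have h : Prov ((A.conj (B.disj C)).imp (C.disj (A.conj B))) :=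
    trans (a6 A B C) (disj_comm _ _)
  trans (trans (conj_intro (a3l _ _) h) (a6 A C (A.conj B))) (disj_comm _ _)

end Prov

namespace IsTheory

variable {α : Type} {X : Set (Formula α)} {A B : Formula α}

theorem mem_of_prov (hX : IsTheory X) (hA : A ∈ X) (h : Prov (A.imp B)) : B ∈ X :=
  hX.2 B ⟨A, [], hA, by simp, h⟩

theorem conj_mem (hX : IsTheory X) (hA : A ∈ X) (hB : B ∈ X) : A.conj B ∈ X :=
  hX.2 _ ⟨A, [B], hA, by simpa using hB, Prov.a1 _⟩

end IsTheory

theorem conjList_mem {α : Type} {X : Set (Formula α)}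
    (hconj : ∀ A B, A ∈ X → B ∈ X → A.conj B ∈ X) (A : Formula α) (l : List (Formula α))
    (hA : A ∈ X) (hl : ∀ C ∈ l, C ∈ X) : conjList A l ∈ X := by
  induction l generalizing A with
  | nil => exact hA
  | cons B l ih =>
    exact ih _ (hconj _ _ hA (hl B (by simp))) fun C hC => hl C (by simp [hC])

theorem isTheory_of_closed {α : Type} {X : Set (Formula α)} (hne : X.Nonempty)
    (hconj : ∀ A B, A ∈ X → B ∈ X → A.conj B ∈ X)
    (himp : ∀ A B, A ∈ X → Prov (A.imp B) → B ∈ X) : IsTheory X := by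
  refine ⟨hne, ?_⟩
  rintro B ⟨A, l, hA, hl, h⟩
  exact himp _ _ (conjList_mem hconj A l hA hl) h

/-- The theory generated by a theory `X` together with a formula `A`. -/
def adjoin {α : Type} (X : Set (Formula α)) (A : Formula α) : Set (Formula α) :=
  {C | ∃ P ∈ X, Prov ((P.conj A).imp C)}

theorem subset_adjoin {α : Type} (X : Set (Formula α)) (A : Formula α) : X ⊆ adjoin X A :=
  fun P hP => ⟨P, hP, Prov.a3l P A⟩

theorem IsTheory.mem_adjoin {α : Type} {X : Set (Formula α)} (hX : IsTheory X)
    (A : Formula α) : A ∈ adjoin X A :=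
  let ⟨P, hP⟩ := hX.1
  ⟨P, hP, Prov.a3r P A⟩

theorem IsTheory.adjoin {α : Type} {X : Set (Formula α)} (hX : IsTheory X) (A : Formula α) :
    IsTheory (adjoin X A) := by
  refine isTheory_of_closed ⟨A, hX.mem_adjoin A⟩ ?_ ?_
  · rintro B C ⟨P, hP, hB⟩ ⟨Q, hQ, hC⟩
    exact ⟨P.conj Q, hX.conj_mem hP hQ, Prov.conj_intro
      (Prov.trans (Prov.conj_mono (Prov.a3l P Q) (Prov.a1 A)) hB)
      (Prov.trans (Prov.conj_mono (Prov.a3r P Q) (Prov.a1 A)) hC)⟩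
  · rintro B C ⟨P, hP, hB⟩ h
    exact ⟨P, hP, hB.trans h⟩

theorem isTheory_sUnion_of_isChain {α : Type} {c : Set (Set (Formula α))}
    (hc : ∀ T ∈ c, IsTheory T) (hchain : IsChain (· ⊆ ·) c) (hne : c.Nonempty) :
    IsTheory (⋃₀ c) := by
  obtain ⟨T, hT⟩ := hne
  obtain ⟨A, hA⟩ := (hc T hT).1
  refine isTheory_of_closed ⟨A, T, hT, hA⟩ ?_ ?_
  · rintro B C ⟨S, hS, hB⟩ ⟨U, hU, hC⟩
    rcases hchain.total hS hU with h | h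
    · exact ⟨U, hU, (hc U hU).conj_mem (h hB) hC⟩
    · exact ⟨S, hS, (hc S hS).conj_mem hB (h hC)⟩
  · rintro B C ⟨S, hS, hB⟩ h
    exact ⟨S, hS, (hc S hS).mem_of_prov hB h⟩

theorem lindenbaum_corollary {α : Type} [Countable α] (X Y : Set (Formula α))
    (hX : IsTheory X) (hY : Y.Nonempty) (hdisj : X ∩ Y = ∅)
    (hYdisj : ∀ A B : Formula α, A ∈ Y → B ∈ Y → A.disj B ∈ Y) :
    ∃ X' : Set (Formula α),
      IsTheory X' ∧ IsPrime X' ∧ X ⊆ X' ∧ X' ∩ Y = ∅ := by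
  obtain ⟨M, hXM, hM⟩ := zorn_subset_nonempty {T | IsTheory T ∧ T ∩ Y = ∅}
    (fun c hc hchain hne => ⟨⋃₀ c,
      ⟨isTheory_sUnion_of_isChain (fun T hT => (hc hT).1) hchain hne, by
        rw [← Set.disjoint_iff_inter_eq_empty, Set.disjoint_sUnion_left]
        exact fun T hT => Set.disjoint_iff_inter_eq_empty.2 (hc hT).2⟩,
      fun T hT => Set.subset_sUnion_of_mem hT⟩) X ⟨hX, hdisj⟩
  obtain ⟨hMT, hMY⟩ := hM.prop
  have adjoin_meets : ∀ A ∉ M, (adjoin M A ∩ Y).Nonempty := fun A hA => by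
    by_contra hempty
    exact hA (hM.le_of_ge ⟨hMT.adjoin A, Set.not_nonempty_iff_eq_empty.1 hempty⟩
      (subset_adjoin M A) (hMT.mem_adjoin A))
  refine ⟨M, hMT, fun A B => ⟨fun hAB => ?_, ?_⟩, hXM, hMY⟩
  · by_contra! hnot
    obtain ⟨C, ⟨P, hP, hC⟩, hCY⟩ := adjoin_meets A hnot.1
    obtain ⟨D, ⟨Q, hQ, hD⟩, hDY⟩ := adjoin_meets B hnot.2
    have hCD : C.disj D ∈ M :=
      hMT.mem_of_prov (hMT.conj_mem (hMT.conj_mem hP hQ) hAB) <|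
        (Prov.conj_disj_distrib _ A B).trans <| Prov.disj_mono
          ((Prov.conj_mono (Prov.a3l P Q) (Prov.a1 A)).trans hC)
          ((Prov.conj_mono (Prov.a3r P Q) (Prov.a1 B)).trans hD)
    exact Set.eq_empty_iff_forall_notMem.1 hMY _ ⟨hCD, hYdisj C D hCY hDY⟩
  · rintro (h | h)
    · exact hMT.mem_of_prov h (Prov.a2l A B)
    · exact hMT.mem_of_prov h (Prov.a2r A B)
end
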